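/- Let K = F_5(z)[y]/(y^2 + 3z^6+z^5+2z^4+4z^3+4z^2+3z+4) be the quadratic function field over F_5(z) obtained by adjoining a root y of the irreducible polynomial Y^2 + (3z^6+z^5+2z^4+4z^3+4z^2+3z+4). Then: (i) the polynomial X^2 + 4z^3+2z^2+4z+1, in the variable X with coefficients in K, is irreducible over K; and (ii) letting M = K[X]/(X^2 + 4z^3+2z^2+4z+1) be the resulting quadratic extension of K, the polynomial W^3 + (3z^3+z^2+2z+1)W + z^5+3z^3+3z, in the variable W with coefficients in M, is irreducible over M. (Consequently the compositum has degree 6 over K; it is the record curve of genus 12 with 36 rational points over F_5.) -/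

import Mathlib

open Polynomial

instance : Fact (Nat.Prime 5) := ⟨by norm_num⟩

/-- `z` denotes the generator `Z` of the rational function field `F₅(z)`. -/
noncomputable def z : RatFunc (ZMod 5) := RatFunc.X

/-- The defining polynomial `Y² + (3z⁶+z⁵+2z⁴+4z³+4z²+3z+4)` of the genus-2 base field
over `F₅`. -/
noncomputable def p : Polynomial (RatFunc (ZMod 5)) :=
  X ^ 2 + C (3 * z ^ 6 + z ^ 5 + 2 * z ^ 4 + 4 * z ^ 3 + 4 * z ^ 2 + 3 * z + 4)

/-- The image of `z` in `K = F₅(z)[y]/(p)`. -/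
noncomputable def zK : AdjoinRoot p := AdjoinRoot.of p z

/-- The quadratic `X² + 4z³+2z²+4z+1` over `K`, defining `M = K[X]/(q)`. -/
noncomputable def q : Polynomial (AdjoinRoot p) :=
  X ^ 2 + C (4 * zK ^ 3 + 2 * zK ^ 2 + 4 * zK + 1)

/-- The image of `z` in `M = K[X]/(q)`. -/
noncomputable def zM : AdjoinRoot q := AdjoinRoot.of q zK

theorem AdjoinRoot.exists_eq_add_mul_root {F : Type*} [Field F] {f : F[X]} (hf : f.Monic)
    (hd : f.natDegree = 2) (x : AdjoinRoot f) :
    ∃ a b : F, x = AdjoinRoot.of f a + AdjoinRoot.of f b * AdjoinRoot.root f := by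
  obtain ⟨g, rfl⟩ := AdjoinRoot.mk_surjective x
  have hlt : (g %ₘ f).natDegree ≤ 1 := by
    have := natDegree_modByMonic_lt g hf (by rintro rfl; simp at hd)
    omega
  obtain ⟨b, a, hba⟩ := exists_eq_X_add_C_of_natDegree_le_one hlt
  refine ⟨a, b, ?_⟩
  have : AdjoinRoot.mk f g = AdjoinRoot.mk f (g %ₘ f) := by
    conv_lhs => rw [← modByMonic_add_div g f]
    simp
  rw [this, hba]
  simp [add_comm]

/-- In characteristic not two, an element of `F` that becomes a square in `F(√-d)` is a square in
`F` or `-d` times a square in `F`. -/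
theorem AdjoinRoot.eq_sq_or_eq_mul_sq {F : Type*} [Field F] {d e : F} (h2 : (2 : F) ≠ 0)
    {x : AdjoinRoot (X ^ 2 + C d)}
    (hx : x ^ 2 = AdjoinRoot.of _ e) : (∃ a, e = a ^ 2) ∨ ∃ b, e = -d * b ^ 2 := by
  have hm : (X ^ 2 + C d).Monic := monic_X_pow_add_C d two_ne_zero
  obtain ⟨a, b, rfl⟩ := exists_eq_add_mul_root hm natDegree_X_pow_add_C x
  have hr : AdjoinRoot.root (X ^ 2 + C d) ^ 2 = -AdjoinRoot.of _ d := by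
    have := AdjoinRoot.mk_self (f := X ^ 2 + C d)
    simp only [map_add, map_pow, AdjoinRoot.mk_X, AdjoinRoot.mk_C] at this
    exact eq_neg_of_add_eq_zero_left this
  have h0 : AdjoinRoot.mk (X ^ 2 + C d) (C (2 * a * b) * X + C (a ^ 2 - d * b ^ 2 - e)) = 0 := by
    simp only [map_add, map_sub, map_mul, map_pow, AdjoinRoot.mk_X, AdjoinRoot.mk_C, map_ofNat]
    linear_combination hx - AdjoinRoot.of _ b ^ 2 * hr
  have h1 : C (2 * a * b) * X + C (a ^ 2 - d * b ^ 2 - e) = 0 := by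
    by_contra hne
    refine AdjoinRoot.mk_ne_zero_of_degree_lt hm hne ?_ h0
    rw [degree_X_pow_add_C two_pos]
    exact degree_linear_lt
  have hab : 2 * a * b = 0 := by
    simpa only [coeff_add, coeff_C_mul, coeff_X_one, coeff_C_succ, mul_one, add_zero, coeff_zero]
      using congrArg (coeff · 1) h1
  have he : a ^ 2 - d * b ^ 2 - e = 0 := by
    simpa only [coeff_add, coeff_C_mul, coeff_X_zero, coeff_C_zero, mul_zero, zero_add, coeff_zero]
      using congrArg (coeff · 0) h1
  rcases mul_eq_zero.1 hab with ha | rfl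
  · obtain rfl : a = 0 := (mul_eq_zero.1 ha).resolve_left h2
    exact .inr ⟨b, by linear_combination -he⟩
  · exact .inl ⟨a, by linear_combination -he⟩

/-- An irreducible cubic stays irreducible over an extension whose degree is prime to three. -/
theorem Polynomial.irreducible_map_of_natDegree_eq_three {F L : Type*} [Field F] [Field L]
    [Algebra F L] {f : F[X]} (hf : Irreducible f) (hm : f.Monic) (hd : f.natDegree = 3)
    (hL : ¬ 3 ∣ Module.finrank F L) : Irreducible (f.map (algebraMap F L)) := by
  have : FiniteDimensional F L :=
    Module.finite_of_finrank_pos (Nat.pos_of_ne_zero fun h => hL (h ▸ dvd_zero 3))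
  have hd' : (f.map (algebraMap F L)).natDegree = 3 := by rw [natDegree_map, hd]
  rw [irreducible_iff_roots_eq_zero_of_degree_le_three (by omega) (by omega),
    Multiset.eq_zero_iff_forall_notMem]
  intro w hw
  have hw' : aeval w f = 0 := by
    rw [mem_roots', IsRoot.def, eval_map_algebraMap] at hw
    exact hw.2
  apply hL
  rw [← hd, minpoly.eq_of_irreducible_of_monic hf hw' hm]
  exact minpoly.degree_dvd (Algebra.IsIntegral.isIntegral w)

/-- A polynomial of odd degree is not a square in the field of rational functions. -/
theorem RatFunc.algebraMap_ne_sq_of_odd_natDegree {F : Type*} [Field F] {f : F[X]}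
    (hf : Odd f.natDegree) (r : RatFunc F) : algebraMap F[X] (RatFunc F) f ≠ r ^ 2 := by
  intro h
  have hf0 : f ≠ 0 := by rintro rfl; simp at hf
  have hr : r ≠ 0 := by
    rintro rfl
    simp [hf0] at h
  have := congrArg RatFunc.intDegree h
  rw [RatFunc.intDegree_polynomial, sq, RatFunc.intDegree_mul hr hr] at this
  obtain ⟨k, hk⟩ := hf
  omega

theorem irreducible_q [Fact (Irreducible p)] : Irreducible q := by
  have h2 : (2 : RatFunc (ZMod 5)) ≠ 0 := by
    have : (2 : ZMod 5) ≠ 0 := by decide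
    rw [← map_ofNat (algebraMap (ZMod 5) (RatFunc (ZMod 5))) 2]
    exact (_root_.map_ne_zero _).2 this
  have hd : q.natDegree = 2 := natDegree_X_pow_add_C
  rw [irreducible_iff_roots_eq_zero_of_degree_le_three (by omega) (by omega),
    Multiset.eq_zero_iff_forall_notMem]
  intro x hx
  have hx' : x ^ 2 = AdjoinRoot.of p (-(4 * z ^ 3 + 2 * z ^ 2 + 4 * z + 1)) := by
    have := (mem_roots'.1 hx).2
    simp only [q, IsRoot.def, eval_add, eval_pow, eval_X, eval_C, zK] at this
    simp only [map_neg, map_add, map_mul, map_pow, map_ofNat, map_one]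
    linear_combination this
  let e : (ZMod 5)[X] := -(4 * X ^ 3 + 2 * X ^ 2 + 4 * X + 1)
  let d : (ZMod 5)[X] := 3 * X ^ 6 + X ^ 5 + 2 * X ^ 4 + 4 * X ^ 3 + 4 * X ^ 2 + 3 * X + 4
  have he : e.natDegree = 3 := by
    dsimp only [e]
    rw [natDegree_neg]
    compute_degree!
  have hd : d.natDegree = 6 := by
    dsimp only [d]
    compute_degree!
  have he0 : e ≠ 0 := by intro h; simp [h] at he
  have hd0 : d ≠ 0 := by intro h; simp [h] at hd
  rcases AdjoinRoot.eq_sq_or_eq_mul_sq h2 hx' with ⟨a, ha⟩ | ⟨b, hb⟩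
  · refine RatFunc.algebraMap_ne_sq_of_odd_natDegree (f := e) (by rw [he]; decide) a ?_
    simpa only [e, RatFunc.algebraMap_X, z, map_neg, map_add, map_mul, map_pow, map_ofNat,
      map_one] using ha
  · refine RatFunc.algebraMap_ne_sq_of_odd_natDegree (f := -(d * e)) ?_
      (algebraMap _ _ d * b) ?_
    · rw [natDegree_neg, natDegree_mul hd0 he0, hd, he]
      decide
    · simp only [e, d, RatFunc.algebraMap_X, z, map_neg, map_add, map_mul, map_pow, map_ofNat,
        map_one] at hb ⊢
      linear_combination
        -(3 * RatFunc.X ^ 6 + RatFunc.X ^ 5 + 2 * RatFunc.X ^ 4 + 4 * RatFunc.X ^ 3 +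
          4 * RatFunc.X ^ 2 + 3 * RatFunc.X + 4) * hb

theorem finrank_adjoinRoot_q [Fact (Irreducible p)] :
    Module.finrank (RatFunc (ZMod 5)) (AdjoinRoot q) = 4 := by
  have hp : p.Monic := monic_X_pow_add_C _ two_ne_zero
  have hq : q.Monic := monic_X_pow_add_C _ two_ne_zero
  rw [← Module.finrank_mul_finrank (RatFunc (ZMod 5)) (AdjoinRoot p) (AdjoinRoot q),
    (AdjoinRoot.powerBasis' hp).finrank, (AdjoinRoot.powerBasis' hq).finrank]
  have hp' : p.natDegree = 2 := natDegree_X_pow_add_C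
  have hq' : q.natDegree = 2 := natDegree_X_pow_add_C
  rw [AdjoinRoot.powerBasis'_dim, AdjoinRoot.powerBasis'_dim, hp', hq']

/-- The cubic over the polynomial ring `F₅[z]`. -/
noncomputable def cubic : (ZMod 5)[X][X] :=
  X ^ 3 + C (3 * X ^ 3 + X ^ 2 + 2 * X + 1) * X + C (X ^ 5 + 3 * X ^ 3 + 3 * X)

theorem monic_cubic : cubic.Monic := by
  unfold cubic
  monicity!

theorem natDegree_cubic : cubic.natDegree = 3 := by
  unfold cubic
  compute_degree!

theorem map_cubic {R : Type*} [CommRing R] (φ : (ZMod 5)[X] →+* R) :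
    cubic.map φ = X ^ 3 + C (3 * φ X ^ 3 + φ X ^ 2 + 2 * φ X + 1) * X +
      C (φ X ^ 5 + 3 * φ X ^ 3 + 3 * φ X) := by
  simp only [cubic, Polynomial.map_add, Polynomial.map_mul, Polynomial.map_pow, map_X, map_C,
    Polynomial.map_ofNat, Polynomial.map_one, map_add, map_mul, map_pow, map_ofNat, map_one]

theorem irreducible_cubic_map :
    Irreducible (cubic.map (algebraMap (ZMod 5)[X] (RatFunc (ZMod 5)))) := by
  have hd : (cubic.map (algebraMap (ZMod 5)[X] (RatFunc (ZMod 5)))).natDegree = 3 := by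
    rw [monic_cubic.natDegree_map, natDegree_cubic]
  rw [irreducible_iff_roots_eq_zero_of_degree_le_three (by omega) (by omega),
    Multiset.eq_zero_iff_forall_notMem]
  intro w hw
  have hw' : aeval w cubic = 0 := by
    rw [mem_roots', IsRoot.def, eval_map_algebraMap] at hw
    exact hw.2
  obtain ⟨v, rfl⟩ := isInteger_of_is_root_of_monic monic_cubic hw'
  rw [aeval_algebraMap_apply, map_eq_zero_iff _ (RatFunc.algebraMap_injective _)] at hw'
  -- At `z = 2` the cubic specialises to one without roots in `F₅`.
  have h2 := congrArg (eval 2) hw'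
  simp [cubic] at h2
  generalize eval 2 v = t at h2
  revert t
  decide

/-- Assuming `p` is irreducible (so that `K = AdjoinRoot p` is the quadratic function field
`F₅(z)(y)`): (i) the quadratic `X² + 4z³+2z²+4z+1` is irreducible over `K`, and (ii) over the
resulting extension `M = K[X]/(X² + 4z³+2z²+4z+1)` the cubic
`W³ + (3z³+z²+2z+1)W + z⁵+3z³+3z` is irreducible. -/
theorem stmt_19 [Fact (Irreducible p)] :
    Irreducible q ∧
    Irreducible (X ^ 3 + C (3 * zM ^ 3 + zM ^ 2 + 2 * zM + 1) * X +
      C (zM ^ 5 + 3 * zM ^ 3 + 3 * zM) : Polynomial (AdjoinRoot q)) := by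
  refine ⟨irreducible_q, ?_⟩
  have : Fact (Irreducible q) := ⟨irreducible_q⟩
  have h := irreducible_map_of_natDegree_eq_three (L := AdjoinRoot q) irreducible_cubic_map
    (monic_cubic.map _) (by rw [monic_cubic.natDegree_map, natDegree_cubic])
    (by rw [finrank_adjoinRoot_q]; decide)
  have hz : ((algebraMap (RatFunc (ZMod 5)) (AdjoinRoot q)).comp
      (algebraMap (ZMod 5)[X] (RatFunc (ZMod 5)))) X = zM := by
    rw [RingHom.comp_apply, RatFunc.algebraMap_X,
      IsScalarTower.algebraMap_apply (RatFunc (ZMod 5)) (AdjoinRoot p) (AdjoinRoot q)]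
    simp only [AdjoinRoot.algebraMap_eq, zM, zK, z]
  rwa [Polynomial.map_map, map_cubic, hz] at h
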